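/- arXiv:1302.6685 — 2 statements merged into one kernel-verified Lean document; each statement's English description precedes it below -/
import Mathlib

section
/- Let G be a digraph on N ≥ 2 nodes with Laplacian L, and suppose G contains a spanning tree. Then there exist an invertible real N×N matrix Φ whose first column is the all-ones vector 1_N, and a real (N−1)×(N−1) matrix L̃ which is Hurwitz (every eigenvalue of L̃ over ℂ has negative real part), such that Φ⁻¹(−L)Φ is the block-diagonal matrix with upper-left 1×1 block 0 and lower-right (N−1)×(N−1) block L̃. -/
open Matrix Finset Polynomial

/-- The Laplacian of the digraph on `Fin N` with edge relation `E`
(`E j i` means there is an edge from `j` to `i`). -/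
def lapMatrix {N : ℕ} (E : Fin N → Fin N → Prop) [DecidableRel E] :
    Matrix (Fin N) (Fin N) ℝ :=
  Matrix.of fun i j =>
    if i = j then ((Finset.univ.filter (fun k => E k i)).card : ℝ)
    else if E j i then -1 else 0

/-- The digraph contains a spanning tree: some root reaches every node
along directed edges (an edge `(j,i)` allows a step from `j` to `i`). -/
def hasSpanningTree {N : ℕ} (E : Fin N → Fin N → Prop) : Prop :=
  ∃ r : Fin N, ∀ i : Fin N, Relation.ReflTransGen E r i

/-- A real square matrix is Hurwitz if every complex eigenvalue has
strictly negative real part. -/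
def IsHurwitz {n : ℕ} (A : Matrix (Fin n) (Fin n) ℝ) : Prop :=
  ∀ z : ℂ, (A.map (Complex.ofReal)).charpoly.IsRoot z → z.re < 0

section Laplacian

variable {N : ℕ} (E : Fin N → Fin N → Prop) [DecidableRel E]

/-- The Laplacian acts by `(L x)_i = ∑_{(j, i) ∈ E} (x_i - x_j)`. -/
lemma lapMatrix_mulVec_apply (hirr : ∀ i, ¬ E i i) (x : Fin N → ℝ) (i : Fin N) :
    (lapMatrix E *ᵥ x) i = ∑ j with E j i, (x i - x j) := by
  have h : ∀ j, lapMatrix E i j * x j =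
      (if i = j then ((univ.filter (fun k => E k i)).card : ℝ) * x j else 0) -
        (if E j i then x j else 0) := by
    intro j
    by_cases hij : i = j
    · subst hij
      simp [lapMatrix, hirr]
    · by_cases hE : E j i <;> simp [lapMatrix, hij, hE]
  simp only [mulVec, dotProduct, h, Finset.sum_sub_distrib, Finset.sum_ite_eq, mem_univ, if_true,
    Finset.sum_const, nsmul_eq_mul, Finset.sum_filter]

lemma lapMatrix_mulVec_one (hirr : ∀ i, ¬ E i i) : lapMatrix E *ᵥ 1 = 0 := by
  ext i
  simp [lapMatrix_mulVec_apply E hirr]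

lemma le_root_of_lapMatrix_mulVec_eq_zero (hirr : ∀ i, ¬ E i i) {r : Fin N}
    (hr : ∀ i, Relation.ReflTransGen E r i) {x : Fin N → ℝ}
    (hx : lapMatrix E *ᵥ x = 0) (i : Fin N) : x i ≤ x r := by
  have : Nonempty (Fin N) := ⟨r⟩
  obtain ⟨m, hm⟩ := Finite.exists_max x
  suffices h : x r = x m from h ▸ hm i
  refine (hr m).head_induction_on (motive := fun a _ => x a = x m) rfl ?_
  intro a c hac _ hc
  have h0 := congrFun hx c
  rw [lapMatrix_mulVec_apply E hirr, Pi.zero_apply,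
    Finset.sum_eq_zero_iff_of_nonneg (fun j _ => by linarith [hm j])] at h0
  linarith [h0 a (by simpa using hac)]

/-- In the presence of a spanning tree the kernel of the Laplacian consists of constants. -/
lemma exists_eq_smul_one_of_lapMatrix_mulVec_eq_zero (hirr : ∀ i, ¬ E i i)
    (htree : hasSpanningTree E) {x : Fin N → ℝ} (hx : lapMatrix E *ᵥ x = 0) :
    ∃ c : ℝ, c • 1 = x := by
  obtain ⟨r, hr⟩ := htree
  refine ⟨x r, funext fun i => ?_⟩
  have h1 := le_root_of_lapMatrix_mulVec_eq_zero E hirr hr hx i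
  have h2 := le_root_of_lapMatrix_mulVec_eq_zero E hirr hr (x := -x)
    (by rw [mulVec_neg, hx, neg_zero]) i
  simp only [Pi.neg_apply, Pi.smul_apply, Pi.one_apply, smul_eq_mul, mul_one] at h2 ⊢
  linarith

/-- A constant vector in the range of the Laplacian vanishes. -/
lemma eq_zero_of_lapMatrix_mulVec_eq_smul_one [NeZero N] (hirr : ∀ i, ¬ E i i)
    {x : Fin N → ℝ} {c : ℝ} (hx : lapMatrix E *ᵥ x = c • 1) : c = 0 := by
  have h : ∀ i, ∑ j with E j i, (x i - x j) = c := fun i => by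
    rw [← lapMatrix_mulVec_apply E hirr, hx]
    simp
  obtain ⟨m, hm⟩ := Finite.exists_max x
  obtain ⟨k, hk⟩ := Finite.exists_min x
  apply le_antisymm
  · rw [← h k]
    exact Finset.sum_nonpos fun j _ => by linarith [hk j]
  · rw [← h m]
    exact Finset.sum_nonneg fun j _ => by linarith [hm j]

/-- By Gershgorin's theorem, the nonzero eigenvalues of `-L` lie in the open left half-plane. -/
lemma re_neg_of_neg_lapMatrix_mulVec_eq_smul (hirr : ∀ i, ¬ E i i) {z : ℂ} (hz : z ≠ 0)
    {u : Fin N → ℂ} (hu : u ≠ 0)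
    (h : (-(lapMatrix E)).map Complex.ofReal *ᵥ u = z • u) : z.re < 0 := by
  have hev : Module.End.HasEigenvalue (toLin' ((-(lapMatrix E)).map Complex.ofReal)) z :=
    Module.End.hasEigenvalue_of_hasEigenvector
      (Module.End.hasEigenvector_iff.mpr
        ⟨Module.End.mem_eigenspace_iff.mpr (by rwa [toLin'_apply]), hu⟩)
  obtain ⟨k, hk⟩ := eigenvalue_mem_ball hev
  set d : ℝ := ((univ.filter (fun j => E j k)).card : ℝ) with hd
  have hsum : ∑ j ∈ univ.erase k, ‖(-(lapMatrix E)).map Complex.ofReal k j‖ = d := by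
    have : ∀ j ∈ univ.erase k, ‖(-(lapMatrix E)).map Complex.ofReal k j‖ =
        if E j k then 1 else 0 := by
      intro j hj
      have hjk : k ≠ j := (Finset.ne_of_mem_erase hj).symm
      by_cases hE : E j k <;> simp [lapMatrix, hjk, hE]
    rw [Finset.sum_congr rfl this, Finset.sum_erase _ (by simp [hirr])]
    simp [hd]
  rw [hsum, mem_closedBall_iff_norm] at hk
  have hkk : (-(lapMatrix E)).map Complex.ofReal k k = ((-d : ℝ) : ℂ) := by
    simp [lapMatrix, hd]
  rw [hkk] at hk
  have hd0 : 0 ≤ d := by positivity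
  have hsq : (z.re + d) ^ 2 + z.im ^ 2 ≤ d ^ 2 := by
    have h1 : ‖z - ((-d : ℝ) : ℂ)‖ ^ 2 ≤ d ^ 2 := by gcongr
    rw [← Complex.normSq_eq_norm_sq, Complex.normSq_apply] at h1
    simp only [Complex.sub_re, Complex.sub_im, Complex.ofReal_re, Complex.ofReal_im] at h1
    nlinarith
  by_contra! hre
  refine hz (Complex.ext ?_ ?_)
  · have := mul_nonneg hre hd0
    exact pow_eq_zero_iff two_ne_zero |>.mp (le_antisymm (by nlinarith [sq_nonneg z.im])
      (sq_nonneg z.re))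
  · have := mul_nonneg hre hd0
    exact pow_eq_zero_iff two_ne_zero |>.mp (le_antisymm (by nlinarith [sq_nonneg z.re])
      (sq_nonneg z.im))

end Laplacian

/-- The block-diagonal matrix with a `1 × 1` zero block followed by `A`. -/
abbrev zeroBlock {R : Type*} [Zero R] {m : ℕ} (A : Matrix (Fin m) (Fin m) R) :
    Matrix (Fin (m + 1)) (Fin (m + 1)) R :=
  Matrix.of (fun i j =>
    Fin.cases (0 : R) (fun i' => Fin.cases (0 : R) (fun j' => A i' j') j) i)

lemma zeroBlock_mulVec_cons_zero {R : Type*} [CommRing R] {m : ℕ} (A : Matrix (Fin m) (Fin m) R)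
    (v : Fin m → R) :
    zeroBlock A *ᵥ (Fin.cons 0 v : Fin (m + 1) → R) = Fin.cons 0 (A *ᵥ v) := by
  ext i
  refine Fin.cases ?_ (fun i => ?_) i
  · simp [mulVec, dotProduct]
  · simp [mulVec, dotProduct, Fin.sum_univ_succ]

lemma zeroBlock_map_ofReal {m : ℕ} (A : Matrix (Fin m) (Fin m) ℝ) :
    (zeroBlock A).map Complex.ofReal = zeroBlock (A.map Complex.ofReal) := by
  ext i j
  refine Fin.cases ?_ (fun i => ?_) i
  · simp
  · refine Fin.cases ?_ (fun j => ?_) j <;> simp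

/-- The Laplacian of a digraph with a spanning tree is block-diagonalized by a basis adapted to
the decomposition into kernel and range. -/
lemma exists_block_diagonalization (n : ℕ) (E : Fin (n + 2) → Fin (n + 2) → Prop)
    [DecidableRel E] (hirr : ∀ i, ¬ E i i) (htree : hasSpanningTree E) :
    ∃ (Φ : Matrix (Fin (n + 2)) (Fin (n + 2)) ℝ) (A : Matrix (Fin (n + 1)) (Fin (n + 1)) ℝ),
      IsUnit Φ ∧ (∀ i, Φ i 0 = 1) ∧ -(lapMatrix E) * Φ = Φ * zeroBlock A := by
  set T := (lapMatrix E).mulVecLin with hT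
  have hker : LinearMap.ker T = Submodule.span ℝ {(1 : Fin (n + 2) → ℝ)} := by
    ext x
    rw [LinearMap.mem_ker, Submodule.mem_span_singleton, hT, mulVecLin_apply]
    constructor
    · exact exists_eq_smul_one_of_lapMatrix_mulVec_eq_zero E hirr htree
    · rintro ⟨c, rfl⟩
      rw [mulVec_smul, lapMatrix_mulVec_one E hirr, smul_zero]
  have hrank : Module.finrank ℝ (LinearMap.range T) = n + 1 := by
    have h := LinearMap.finrank_range_add_finrank_ker T
    rw [hker, finrank_span_singleton one_ne_zero, Module.finrank_fin_fun] at h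
    omega
  let b := Module.finBasisOfFinrankEq ℝ (LinearMap.range T) hrank
  let A : Matrix (Fin (n + 1)) (Fin (n + 1)) ℝ :=
    Matrix.of fun i j => -(b.repr ⟨T (b j), LinearMap.mem_range_self T _⟩ i)
  let Φ : Matrix (Fin (n + 2)) (Fin (n + 2)) ℝ :=
    Matrix.of fun i => Fin.cons 1 (fun k => (b k : Fin (n + 2) → ℝ) i)
  have hA : ∀ j, ∑ i, A i j • (b i : Fin (n + 2) → ℝ) = -(lapMatrix E *ᵥ (b j).1) := by
    intro j
    have h := congrArg Subtype.val (b.sum_repr ⟨T (b j), LinearMap.mem_range_self T _⟩)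
    simp only [Submodule.coe_sum, Submodule.coe_smul] at h
    simp only [A, Matrix.of_apply, neg_smul, Finset.sum_neg_distrib, h]
    rfl
  have hΦv : ∀ v : Fin (n + 2) → ℝ,
      Φ *ᵥ v = v 0 • 1 + ((∑ i, v i.succ • b i : LinearMap.range T) : Fin (n + 2) → ℝ) := by
    intro v
    ext i
    simp [Φ, mulVec, dotProduct, Fin.sum_univ_succ, Finset.sum_apply, mul_comm]
  refine ⟨Φ, A, ?_, fun i => rfl, ?_⟩
  · rw [← mulVec_injective_iff_isUnit]
    refine (injective_iff_map_eq_zero Φ.mulVecLin).mpr fun v hv => ?_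
    rw [mulVecLin_apply, hΦv] at hv
    obtain ⟨x, hx⟩ := (∑ i, v i.succ • b i : LinearMap.range T).2
    rw [← hx] at hv
    have hv0 : v 0 = 0 := by
      have h : lapMatrix E *ᵥ x = (-v 0) • 1 := by
        rw [neg_smul]
        exact eq_neg_of_add_eq_zero_right hv
      exact neg_eq_zero.mp (eq_zero_of_lapMatrix_mulVec_eq_smul_one E hirr h)
    rw [hv0, zero_smul, zero_add, hx] at hv
    have hs := Fintype.linearIndependent_iff.mp b.linearIndependent (fun i => v i.succ)
      (Subtype.ext hv)
    ext i
    exact Fin.cases hv0 hs i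
  · ext i j
    refine Fin.cases ?_ (fun j => ?_) j
    · have h := congrFun (lapMatrix_mulVec_one E hirr) i
      simp only [mulVec, dotProduct, Pi.one_apply, Pi.zero_apply, mul_one] at h
      simp only [Matrix.mul_apply, Matrix.neg_apply, neg_mul, Finset.sum_neg_distrib]
      rw [Fin.sum_univ_succ (fun k => Φ i k * zeroBlock A k 0)]
      simp [Φ, h]
    · have h := congrFun (hA j) i
      rw [Matrix.mul_apply, Matrix.mul_apply,
        Fin.sum_univ_succ (fun k => Φ i k * zeroBlock A k j.succ)]
      simp only [Finset.sum_apply, Pi.smul_apply, smul_eq_mul, Pi.neg_apply, mulVec,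
        dotProduct] at h
      simpa [Φ, mul_comm] using h.symm

theorem stmt_5 (n : ℕ) (E : Fin (n + 2) → Fin (n + 2) → Prop) [DecidableRel E]
    (hirr : ∀ i, ¬ E i i) (htree : hasSpanningTree E) :
    ∃ (Φ : Matrix (Fin (n + 2)) (Fin (n + 2)) ℝ)
      (Lt : Matrix (Fin (n + 1)) (Fin (n + 1)) ℝ),
      IsUnit Φ ∧ (∀ i, Φ i 0 = 1) ∧ IsHurwitz Lt ∧
      Φ⁻¹ * (-(lapMatrix E)) * Φ =
        Matrix.of (fun i j =>
          Fin.cases (0 : ℝ)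
            (fun i' => Fin.cases (0 : ℝ) (fun j' => Lt i' j') j) i) := by
  obtain ⟨Φ, A, hΦ, hΦ1, hmul⟩ := exists_block_diagonalization n E hirr htree
  have hdet : IsUnit Φ.det := (isUnit_iff_isUnit_det Φ).mp hΦ
  refine ⟨Φ, A, hΦ, hΦ1, ?_, ?_⟩
  · have hA : A.det ≠ 0 := by
      intro h0
      obtain ⟨v, hv, hAv⟩ := exists_mulVec_eq_zero_iff.mpr h0
      have h1 : lapMatrix E *ᵥ (Φ *ᵥ Fin.cons 0 v) = 0 := by
        rw [← neg_inj, ← neg_mulVec, mulVec_mulVec, hmul, ← mulVec_mulVec,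
          zeroBlock_mulVec_cons_zero, hAv]
        have : (Fin.cons 0 0 : Fin (n + 2) → ℝ) = 0 := by
          ext i
          refine Fin.cases ?_ (fun i => ?_) i <;> simp
        rw [this, mulVec_zero, neg_zero]
      obtain ⟨c, hc⟩ := exists_eq_smul_one_of_lapMatrix_mulVec_eq_zero E hirr htree h1
      have h2 : Φ *ᵥ Pi.single 0 c = Φ *ᵥ Fin.cons 0 v := by
        rw [← hc]
        ext i
        simp [hΦ1]
      have h3 := mulVec_injective_iff_isUnit.mpr hΦ h2
      refine hv (funext fun i => ?_)
      have h4 := congrFun h3 i.succ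
      simpa using h4.symm
    intro z hz
    have hdetz : (scalar (Fin (n + 1)) z - A.map Complex.ofReal).det = 0 := by
      rw [← eval_charpoly]
      exact hz
    obtain ⟨v, hv, hAv⟩ := exists_mulVec_eq_zero_iff.mpr hdetz
    have hAv' : A.map Complex.ofReal *ᵥ v = z • v := by
      rw [sub_mulVec, sub_eq_zero] at hAv
      rw [← hAv]
      ext i
      simp [scalar_apply, mulVec_diagonal]
    have hz0 : z ≠ 0 := by
      rintro rfl
      rw [zero_smul] at hAv'
      have h0 : (A.map Complex.ofReal).det = 0 := exists_mulVec_eq_zero_iff.mp ⟨v, hv, hAv'⟩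
      have h1 := RingHom.map_det Complex.ofRealHom A
      rw [RingHom.mapMatrix_apply] at h1
      exact hA (Complex.ofReal_eq_zero.mp (h1.trans h0))
    have hΦc : IsUnit (Φ.map Complex.ofReal) := hΦ.map (Complex.ofRealHom.mapMatrix)
    refine re_neg_of_neg_lapMatrix_mulVec_eq_smul E hirr hz0
      (u := Φ.map Complex.ofReal *ᵥ Fin.cons 0 v) ?_ ?_
    · intro h0
      have h1 := mulVec_injective_iff_isUnit.mpr hΦc (h0.trans (mulVec_zero _).symm)
      exact hv (funext fun i => by simpa using congrFun h1 i.succ)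
    · have hmulc : (-(lapMatrix E)).map Complex.ofReal * Φ.map Complex.ofReal =
          Φ.map Complex.ofReal * zeroBlock (A.map Complex.ofReal) := by
        rw [← zeroBlock_map_ofReal]
        have := congrArg (Complex.ofRealHom.mapMatrix) hmul
        rwa [map_mul, map_mul] at this
      rw [mulVec_mulVec, hmulc, ← mulVec_mulVec, zeroBlock_mulVec_cons_zero, hAv', ← mulVec_smul]
      congr 1
      ext i
      refine Fin.cases ?_ (fun i => ?_) i <;> simp
  · rw [Matrix.mul_assoc, hmul, nonsing_inv_mul_cancel_left _ _ hdet]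
end

section
/- Let G be a digraph on N ≥ 1 nodes with Laplacian L, suppose G is balanced and contains a spanning tree, and let π ∈ ℝ^N be a row vector with Σ_{i=1}^N πᵢ = 1, πᵢ ≥ 0 for all i, and πL = 0. Then π = (1/N)·1_Nᵀ, i.e., πᵢ = 1/N for every i. -/
open Matrix Finset

/-- A digraph is balanced if each node's in-degree equals its out-degree. -/
def isBalanced {N : ℕ} (E : Fin N → Fin N → Prop) [DecidableRel E] : Prop :=
  ∀ i : Fin N,
    (Finset.univ.filter (fun j => E j i)).card =
      (Finset.univ.filter (fun j => E i j)).card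

/-- The `j`-th entry of the row vector `π * L`, for a digraph without self-loops. -/
theorem vecMul_lapMatrix_apply {N : ℕ} {E : Fin N → Fin N → Prop} [DecidableRel E]
    (hirr : ∀ i, ¬ E i i) (π : Fin N → ℝ) (j : Fin N) :
    Matrix.vecMul π (lapMatrix E) j =
      π j * ((Finset.univ.filter (fun k => E k j)).card : ℝ) -
        ∑ i, if E j i then π i else 0 := by
  have h : ∀ i, π i * lapMatrix E i j =
      (if i = j then π j * ((Finset.univ.filter (fun k => E k j)).card : ℝ) else 0) -
        if E j i then π i else 0 := by
    intro i
    by_cases hij : i = j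
    · subst hij
      simp [lapMatrix, hirr]
    · by_cases hE : E j i <;> simp [lapMatrix, hij, hE]
  simp only [Matrix.vecMul, dotProduct, h, Finset.sum_sub_distrib]
  simp

/-- A left null vector of the Laplacian of a balanced digraph is constant along edges. -/
theorem eq_of_edge_of_vecMul_lapMatrix_eq_zero {N : ℕ} {E : Fin N → Fin N → Prop}
    [DecidableRel E] (hirr : ∀ i, ¬ E i i) (hbal : isBalanced E) {π : Fin N → ℝ}
    (hπL : Matrix.vecMul π (lapMatrix E) = 0) {j i : Fin N} (hji : E j i) :
    π j = π i := by
  have hin (j : Fin N) : ∑ i, (if E j i then π i else 0) =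
      π j * ((Finset.univ.filter (fun k => E k j)).card : ℝ) := by
    have := vecMul_lapMatrix_apply hirr π j
    rw [hπL, Pi.zero_apply] at this
    linarith
  have hout (j : Fin N) : ((Finset.univ.filter (fun k => E j k)).card : ℝ) =
      ((Finset.univ.filter (fun k => E k j)).card : ℝ) := by
    rw [hbal j]
  have henergy : ∑ j, ∑ i, (if E j i then (π j - π i) ^ 2 else 0) = 0 := by
    have hexp (j i : Fin N) : (if E j i then (π j - π i) ^ 2 else 0) =
        π j ^ 2 * (if E j i then 1 else 0) + π i ^ 2 * (if E j i then 1 else 0) -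
          2 * π j * (if E j i then π i else 0) := by
      split_ifs <;> ring
    simp only [hexp, Finset.sum_sub_distrib, Finset.sum_add_distrib]
    rw [Finset.sum_comm (f := fun j i => π i ^ 2 * (if E j i then (1 : ℝ) else 0))]
    simp only [← Finset.mul_sum, hin, Finset.sum_boole, hout]
    rw [← Finset.sum_add_distrib, ← Finset.sum_sub_distrib]
    exact Finset.sum_eq_zero fun j _ => by ring
  have hnonneg (j i : Fin N) : 0 ≤ if E j i then (π j - π i) ^ 2 else 0 := by
    split_ifs <;> positivity
  have hj := (Finset.sum_eq_zero_iff_of_nonneg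
    fun j _ => Finset.sum_nonneg fun i _ => hnonneg j i).mp henergy j (Finset.mem_univ j)
  have hi := (Finset.sum_eq_zero_iff_of_nonneg
    fun i _ => hnonneg j i).mp hj i (Finset.mem_univ i)
  rw [if_pos hji] at hi
  exact sub_eq_zero.mp (pow_eq_zero_iff two_ne_zero |>.mp hi)

theorem stmt_7 (N : ℕ) (hN : 1 ≤ N) (E : Fin N → Fin N → Prop) [DecidableRel E]
    (hirr : ∀ i, ¬ E i i) (hbal : isBalanced E) (htree : hasSpanningTree E)
    (π : Fin N → ℝ) (hπsum : ∑ i, π i = 1) (hπpos : ∀ i, 0 ≤ π i)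
    (hπL : Matrix.vecMul π (lapMatrix E) = 0) :
    π = fun _ => (1 : ℝ) / N := by
  obtain ⟨r, hr⟩ := htree
  have hconst (i : Fin N) : π i = π r := by
    induction hr i with
    | refl => rfl
    | tail _ hE ih =>
      rw [← eq_of_edge_of_vecMul_lapMatrix_eq_zero hirr hbal hπL hE, ih]
  have hN0 : (N : ℝ) ≠ 0 := by positivity
  simp only [hconst, Finset.sum_const, Finset.card_univ, Fintype.card_fin, nsmul_eq_mul] at hπsum
  funext i
  rw [hconst i, eq_div_iff hN0, mul_comm, hπsum]
end
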